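/- arXiv:1907.09577 — 2 statements merged into one kernel-verified Lean document; each statement's English description precedes it below -/
import Mathlib

section
/- The class K has the weak amalgamation property: for every H ∈ K there exists G ∈ K containing H as an induced labeled subgraph, such that for all X, Y ∈ K and all label-preserving graph embeddings f : G → X and g : G → Y, there exist W ∈ K and label-preserving graph embeddings f' : X → W and g' : Y → W with f' ∘ f and g' ∘ g agreeing on H. -/
/-- The class `K`: finite simple graphs with vertices labeled by `ℤ/5ℤ` which are
acyclic and in which no vertex `v` has two neighbors labeled `ℓ v + 1` and `ℓ v + 2`. -/
def inK {V : Type} (G : SimpleGraph V) (ℓ : V → ZMod 5) : Prop :=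
  Finite V ∧ G.IsAcyclic ∧
    ∀ v w₁ w₂ : V, G.Adj v w₁ → G.Adj v w₂ → ℓ w₁ = ℓ v + 1 → ℓ w₂ = ℓ v + 2 → False

namespace SimpleGraph

/-- A graph is acyclic if all its edges outside some acyclic graph are bridges. -/
theorem isAcyclic_of_isBridge_of_not_adj {V : Type*} {A W : SimpleGraph V} (hA : A.IsAcyclic)
    (h : ∀ u v, W.Adj u v → ¬ A.Adj u v → W.IsBridge s(u, v)) : W.IsAcyclic := by
  intro v p hp
  refine hA (p.transfer A fun e he ↦ ?_) (hp.transfer _)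
  induction e with
  | h a b =>
    by_contra hab
    exact (h a b (p.edges_subset_edgeSet he) hab).notMem_edges_of_isCycle hp he

/-- Reachability from a fixed vertex can be proved by induction on the last step. -/
theorem Reachable.induction_tail {V : Type*} {G : SimpleGraph V} {u v : V} {P : V → Prop}
    (h : G.Reachable u v) (refl : P u) (tail : ∀ a b, G.Adj a b → P a → P b) : P v := by
  rw [reachable_iff_reflTransGen] at h
  induction h with
  | refl => exact refl
  | tail _ hab ih => exact tail _ _ hab ih

theorem IsAcyclic.map {V W : Type*} {G : SimpleGraph V} (hG : G.IsAcyclic) (f : V ↪ W) :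
    (G.map f).IsAcyclic := by
  rw [isAcyclic_iff_forall_adj_isBridge] at hG ⊢
  intro x y hxy
  obtain ⟨a, b, hab, rfl, rfl⟩ := (map_adj _ _ _ _).1 hxy
  rw [isBridge_iff]
  intro hr
  have key : ∃ c, f c = f b ∧ (G.deleteEdges {s(a, b)}).Reachable a c := by
    refine hr.induction_tail (P := fun w ↦ ∃ c, f c = w ∧
      (G.deleteEdges {s(a, b)}).Reachable a c) ⟨a, rfl, .refl _⟩ ?_
    rintro _ w hw ⟨c, rfl, hc⟩
    rw [deleteEdges_adj] at hw
    obtain ⟨c', d, hcd, hc', rfl⟩ := (map_adj _ _ _ _).1 hw.1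
    obtain rfl := f.injective hc'
    refine ⟨d, rfl, hc.trans (Adj.reachable ?_)⟩
    rw [deleteEdges_adj]
    refine ⟨hcd, fun h ↦ hw.2 ?_⟩
    have := congrArg (Sym2.map f) (Set.mem_singleton_iff.1 h)
    simpa using this
  obtain ⟨c, hc, hr⟩ := key
  obtain rfl := f.injective hc
  exact isBridge_iff.1 (hG hab) hr

/-- If `A` and `B` live on `S` and `T`, and `S ∩ T` is connected in `A ⊓ B`, then an edge of `A`
outside `B` which is a bridge of `A` is still a bridge of `A ⊔ B`. -/
theorem IsBridge.sup_of_reachable_inter {V : Type*} {A B : SimpleGraph V} {S T : Set V}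
    (hS : ∀ a b, A.Adj a b → a ∈ S) (hT : ∀ a b, B.Adj a b → a ∈ T)
    (hC : ∀ c ∈ S ∩ T, ∀ d ∈ S ∩ T, (A ⊓ B).Reachable c d) {u v : V}
    (huv : A.Adj u v) (hB : ¬ B.Adj u v) (h : A.IsBridge s(u, v)) :
    (A ⊔ B).IsBridge s(u, v) := by
  rw [isBridge_iff] at h ⊢
  have hle : A ⊓ B ≤ A.deleteEdges {s(u, v)} := by
    intro a b hab
    rw [deleteEdges_adj]
    refine ⟨hab.1, fun he ↦ hB ?_⟩
    rw [← mem_edgeSet, ← Set.mem_singleton_iff.1 he]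
    exact hab.2
  have hC' : ∀ c ∈ S ∩ T, ∀ d ∈ S ∩ T, (A.deleteEdges {s(u, v)}).Reachable c d :=
    fun c hc d hd ↦ (hC c hc d hd).mono hle
  intro hr
  refine h ((hr.induction_tail (P := fun w ↦
    (w ∈ S → (A.deleteEdges {s(u, v)}).Reachable u w) ∧
    (w ∈ T → ∀ c ∈ S ∩ T, (A.deleteEdges {s(u, v)}).Reachable u c)) ?_ ?_).1 (hS _ _ huv.symm))
  · exact ⟨fun _ ↦ .refl _, fun hu ↦ hC' u ⟨hS _ _ huv, hu⟩⟩
  · rintro a b hab ⟨ha, ha'⟩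
    rw [deleteEdges_adj] at hab
    obtain ⟨hab | hab, hne⟩ := hab
    · have hb : (A.deleteEdges {s(u, v)}).Reachable u b :=
        (ha (hS _ _ hab)).trans (Adj.reachable (by rw [deleteEdges_adj]; exact ⟨hab, hne⟩))
      exact ⟨fun _ ↦ hb, fun hbT c hc ↦ hb.trans (hC' b ⟨hS _ _ hab.symm, hbT⟩ c hc)⟩
    · have hb := ha' (hT _ _ hab)
      exact ⟨fun hbS ↦ hb b ⟨hbS, hT _ _ hab.symm⟩, fun _ ↦ hb⟩

/-- Gluing two acyclic graphs along a connected common part yields an acyclic graph. -/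
theorem IsAcyclic.sup_of_reachable_inter {V : Type*} {A B : SimpleGraph V} {S T : Set V}
    (hA : A.IsAcyclic) (hB : B.IsAcyclic)
    (hS : ∀ a b, A.Adj a b → a ∈ S) (hT : ∀ a b, B.Adj a b → a ∈ T)
    (hC : ∀ c ∈ S ∩ T, ∀ d ∈ S ∩ T, (A ⊓ B).Reachable c d) : (A ⊔ B).IsAcyclic := by
  refine isAcyclic_of_isBridge_of_not_adj (A := A ⊓ B) (hA.anti inf_le_left) ?_
  rw [isAcyclic_iff_forall_adj_isBridge] at hA hB
  rintro u v (h | h) hn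
  · exact (hA h).sup_of_reachable_inter hS hT hC h fun h' ↦ hn ⟨h, h'⟩
  · rw [sup_comm]
    refine (hB h).sup_of_reachable_inter hT hS ?_ h fun h' ↦ hn ⟨h', h⟩
    rwa [Set.inter_comm, inf_comm]

/-- The graph `G` together with a pendant vertex `inr u` at each vertex `inl u`. -/
def withPendants {U : Type*} (G : SimpleGraph U) : SimpleGraph (U ⊕ U) where
  Adj
    | .inl a, .inl b => G.Adj a b
    | .inl a, .inr b => a = b
    | .inr a, .inl b => a = b
    | .inr _, .inr _ => False
  symm := ⟨by
    rintro (a | a) (b | b) h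
    exacts [SimpleGraph.Adj.symm h, h.symm, h.symm, h]⟩
  loopless := ⟨by
    rintro (a | a) h
    exacts [G.loopless.irrefl a h, h]⟩

theorem IsAcyclic.withPendants {U : Type*} {G : SimpleGraph U} (hG : G.IsAcyclic) :
    G.withPendants.IsAcyclic := by
  have pendant : ∀ u, G.withPendants.IsBridge s(.inr u, .inl u) := by
    intro u
    rw [isBridge_iff]
    intro hr
    have := hr.induction_tail (P := fun w ↦ w = .inr u) rfl <| by
      rintro a (b | b) hab rfl
      · rw [deleteEdges_adj] at hab
        obtain rfl : u = b := hab.1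
        exact absurd rfl hab.2
      · rw [deleteEdges_adj] at hab
        exact hab.1.elim
    exact Sum.inl_ne_inr this
  refine isAcyclic_of_isBridge_of_not_adj (hG.map .inl) ?_
  rintro (a | a) (b | b) hab hn
  · exact absurd ((map_adj _ _ _ _).2 ⟨a, b, hab, rfl, rfl⟩) hn
  · obtain rfl : a = b := hab
    rw [Sym2.eq_swap]
    exact pendant a
  · obtain rfl : a = b := hab
    exact pendant a
  · exact hab.elim

/-- The graph obtained from the labeled graph `H` by adding a five-cycle with one vertex for each
label, and joining every vertex of `H` to the cycle vertex of its own label. -/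
def withLabelCycle {V : Type*} (H : SimpleGraph V) (ℓ : V → ZMod 5) :
    SimpleGraph (V ⊕ ZMod 5) where
  Adj
    | .inl a, .inl b => H.Adj a b
    | .inl a, .inr i => ℓ a = i
    | .inr i, .inl a => ℓ a = i
    | .inr i, .inr j => j = i + 1 ∨ i = j + 1
  symm := ⟨by
    rintro (a | a) (b | b) h
    exacts [SimpleGraph.Adj.symm h, h, h, h.symm]⟩
  loopless := ⟨by
    rintro (a | a) h
    exacts [H.loopless.irrefl a h, (by decide : ∀ i : ZMod 5, ¬ (i = i + 1 ∨ i = i + 1)) a h]⟩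

theorem connected_withLabelCycle {V : Type*} (H : SimpleGraph V) (ℓ : V → ZMod 5) :
    (H.withLabelCycle ℓ).Connected := by
  rw [connected_iff_exists_forall_reachable]
  have cycle : ∀ n : ℕ, (H.withLabelCycle ℓ).Reachable (.inr 0) (.inr n) := by
    intro n
    induction n with
    | zero => simp
    | succ n ih => exact ih.trans (Adj.reachable (Or.inl (by push_cast; rfl)))
  have cycle' : ∀ i : ZMod 5, (H.withLabelCycle ℓ).Reachable (.inr 0) (.inr i) := fun i ↦ by
    simpa using cycle i.val
  refine ⟨.inr 0, ?_⟩
  rintro (a | i)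
  · exact (cycle' (ℓ a)).trans (Adj.reachable (show ℓ a = ℓ a from rfl))
  · exact cycle' i

end SimpleGraph

open SimpleGraph

/-- Every member of `K` embeds in a tree belonging to `K`. -/
theorem inK.exists_isTree {V : Type} {H : SimpleGraph V} {ℓ : V → ZMod 5} (hH : inK H ℓ) :
    ∃ (U : Type) (T : SimpleGraph U) (ℓT : U → ZMod 5) (ι : H ↪g T),
      inK T ℓT ∧ T.IsTree ∧ ∀ v, ℓT (ι v) = ℓ v := by
  obtain ⟨hfin, hac, hlab⟩ := hH
  have hle : H.map Function.Embedding.inl ≤ H.withLabelCycle ℓ := by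
    intro x y hxy
    obtain ⟨a, b, hab, rfl, rfl⟩ := (map_adj _ _ _ _).1 hxy
    exact hab
  obtain ⟨T, hHT, hTM, hT⟩ :=
    (H.connected_withLabelCycle ℓ).exists_isTree_le_of_le_of_isAcyclic hle (hac.map _)
  refine ⟨V ⊕ ZMod 5, T, Sum.elim ℓ id, ⟨.inl, fun {a b} ↦ ⟨fun h ↦ hTM h, fun h ↦ hHT ?_⟩⟩,
    ⟨inferInstance, hT.isAcyclic, ?_⟩, hT, fun _ ↦ rfl⟩
  · exact (map_adj _ _ _ _).2 ⟨a, b, h, rfl, rfl⟩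
  · intro v w₁ w₂ h₁ h₂
    replace h₁ := hTM h₁
    replace h₂ := hTM h₂
    have one : ∀ i : ZMod 5, i ≠ i + 1 := by decide
    have two : ∀ i : ZMod 5, i ≠ i + 2 := by decide
    have cycle : ∀ i j : ZMod 5, (j = i + 1 ∨ i = j + 1) → j ≠ i + 2 := by decide
    rcases v with v | i <;> rcases w₁ with w₁ | j <;> rcases w₂ with w₂ | k <;>
      simp only [withLabelCycle, Sum.elim_inl, Sum.elim_inr, id] at h₁ h₂ ⊢
    all_goals grind

/-- Every member of `K` embeds in a member of `K` in which all the old vertices have a neighbor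
forbidding one of the two kinds of further neighbors. -/
theorem inK.exists_decided {U : Type} {T : SimpleGraph U} {ℓ : U → ZMod 5} (hT : inK T ℓ) :
    ∃ (V' : Type) (G : SimpleGraph V') (ℓG : V' → ZMod 5) (e : T ↪g G),
      inK G ℓG ∧ (∀ u, ℓG (e u) = ℓ u) ∧
      ∀ u, ∃ w, G.Adj (e u) w ∧ (ℓG w = ℓ u + 1 ∨ ℓG w = ℓ u + 2) := by
  classical
  obtain ⟨hfin, hac, hlab⟩ := hT
  let p : U → ZMod 5 := fun u ↦ ℓ u + if ∃ w, T.Adj u w ∧ ℓ w = ℓ u + 2 then 2 else 1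
  have hp : ∀ u, (p u = ℓ u + 2 ∧ ∃ w, T.Adj u w ∧ ℓ w = ℓ u + 2) ∨
      (p u = ℓ u + 1 ∧ ¬ ∃ w, T.Adj u w ∧ ℓ w = ℓ u + 2) := by
    intro u
    by_cases h : ∃ w, T.Adj u w ∧ ℓ w = ℓ u + 2
    · exact Or.inl ⟨by simp only [p, if_pos h], h⟩
    · exact Or.inr ⟨by simp only [p, if_neg h], h⟩
  clear_value p
  have ne : ∀ i : ZMod 5, i + 1 ≠ i + 2 := by decide
  refine ⟨U ⊕ U, T.withPendants, Sum.elim ℓ p, ⟨.inl, Iff.rfl⟩,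
    ⟨inferInstance, hac.withPendants, ?_⟩, fun _ ↦ rfl, fun u ↦ ⟨.inr u, rfl, ?_⟩⟩
  · rintro (v | v) (w₁ | w₁) (w₂ | w₂) h₁ h₂ <;>
      simp only [withPendants, Sum.elim_inl, Sum.elim_inr] at h₁ h₂ ⊢
    all_goals grind
  · rcases hp u with h | h
    exacts [Or.inr h.1, Or.inl h.1]

/-- Pushouts of injections, with induced maps to a fixed set of labels. -/
theorem exists_pushout_of_injective {U A B L : Type} {f : U → A} {g : U → B}
    (hf : f.Injective) (hg : g.Injective) (ℓA : A → L) (ℓB : B → L)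
    (hℓ : ∀ u, ℓA (f u) = ℓB (g u)) [Finite A] [Finite B] :
    ∃ (C : Type) (i : A ↪ C) (j : B ↪ C) (ℓC : C → L), Finite C ∧
      (∀ u, i (f u) = j (g u)) ∧ (∀ a b, i a = j b → ∃ u, a = f u ∧ b = g u) ∧
      (∀ a, ℓC (i a) = ℓA a) ∧ (∀ b, ℓC (j b) = ℓB b) := by
  classical
  let j : B → A ⊕ {b // b ∉ Set.range g} := fun b ↦
    if h : b ∈ Set.range g then .inl (f h.choose) else .inr ⟨b, h⟩
  have hj : ∀ u, j (g u) = .inl (f u) := by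
    intro u
    have h : g u ∈ Set.range g := ⟨u, rfl⟩
    simp only [j, dif_pos h, hg h.choose_spec]
  have hj' : ∀ b (h : b ∉ Set.range g), j b = .inr ⟨b, h⟩ := fun b h ↦ by simp only [j, dif_neg h]
  clear_value j
  refine ⟨A ⊕ {b // b ∉ Set.range g}, .inl, ⟨j, ?_⟩, Sum.elim ℓA (fun b ↦ ℓB b), inferInstance,
    fun u ↦ (hj u).symm, ?_, fun _ ↦ rfl, ?_⟩
  · intro b b' h
    by_cases hb : b ∈ Set.range g <;> by_cases hb' : b' ∈ Set.range g
    · obtain ⟨u, rfl⟩ := hb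
      obtain ⟨u', rfl⟩ := hb'
      rw [hj, hj] at h
      rw [hf (Sum.inl_injective h)]
    · obtain ⟨u, rfl⟩ := hb
      rw [hj, hj' _ hb'] at h
      exact (Sum.inl_ne_inr h).elim
    · obtain ⟨u', rfl⟩ := hb'
      rw [hj, hj' _ hb] at h
      exact (Sum.inr_ne_inl h).elim
    · rw [hj' _ hb, hj' _ hb'] at h
      exact congrArg Subtype.val (Sum.inr_injective h)
  · intro a b h
    by_cases hb : b ∈ Set.range g
    · obtain ⟨u, rfl⟩ := hb
      exact ⟨u, Sum.inl_injective (h.trans (hj u)), rfl⟩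
    · exact (Sum.inl_ne_inr (h.trans (hj' b hb))).elim
  · intro b
    by_cases hb : b ∈ Set.range g
    · obtain ⟨u, rfl⟩ := hb
      exact (congrArg _ (hj u)).trans (hℓ u)
    · exact congrArg (Sum.elim ℓA fun b : {b // b ∉ Set.range g} ↦ ℓB b) (hj' b hb)

/-- Two members of `K` can be amalgamated over a common connected part if each of its vertices
admits the same one of the two kinds of neighbors in both of them. -/
theorem inK.exists_amalgam {U VX VY : Type} {T : SimpleGraph U} (hT : T.Preconnected)
    {X : SimpleGraph VX} {ℓX : VX → ZMod 5} {Y : SimpleGraph VY} {ℓY : VY → ZMod 5}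
    (hX : inK X ℓX) (hY : inK Y ℓY) (f : T ↪g X) (g : T ↪g Y)
    (hℓ : ∀ u, ℓX (f u) = ℓY (g u))
    (hdec : ∀ u, ∃ x y, X.Adj (f u) x ∧ Y.Adj (g u) y ∧ ℓX x = ℓY y ∧
      (ℓX x = ℓX (f u) + 1 ∨ ℓX x = ℓX (f u) + 2)) :
    ∃ (VW : Type) (W : SimpleGraph VW) (ℓW : VW → ZMod 5) (f' : X ↪g W) (g' : Y ↪g W),
      inK W ℓW ∧ (∀ v, ℓW (f' v) = ℓX v) ∧ (∀ v, ℓW (g' v) = ℓY v) ∧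
      ∀ u, f' (f u) = g' (g u) := by
  obtain ⟨finX, acX, labX⟩ := hX
  obtain ⟨finY, acY, labY⟩ := hY
  obtain ⟨C, i, j, ℓC, finC, hij, hij', hℓi, hℓj⟩ :=
    exists_pushout_of_injective f.injective g.injective ℓX ℓY hℓ
  have adjX : ∀ a b, (X.map i).Adj (i a) (i b) ↔ X.Adj a b := fun a b ↦ map_adj_apply
  have adjY : ∀ a b, (Y.map j).Adj (j a) (j b) ↔ Y.Adj a b := fun a b ↦ map_adj_apply
  have restrictX : ∀ a b, (X.map i ⊔ Y.map j).Adj (i a) (i b) ↔ X.Adj a b := by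
    refine fun a b ↦ ⟨?_, fun h ↦ Or.inl ((adjX a b).2 h)⟩
    rintro (h | h)
    · exact (adjX a b).1 h
    · obtain ⟨c, d, hcd, hc, hd⟩ := (map_adj _ _ _ _).1 h
      obtain ⟨u, rfl, rfl⟩ := hij' a c hc.symm
      obtain ⟨v, rfl, rfl⟩ := hij' b d hd.symm
      exact f.map_adj_iff.2 (g.map_adj_iff.1 hcd)
  have restrictY : ∀ a b, (X.map i ⊔ Y.map j).Adj (j a) (j b) ↔ Y.Adj a b := by
    refine fun a b ↦ ⟨?_, fun h ↦ Or.inr ((adjY a b).2 h)⟩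
    rintro (h | h)
    · obtain ⟨c, d, hcd, hc, hd⟩ := (map_adj _ _ _ _).1 h
      obtain ⟨u, rfl, rfl⟩ := hij' c a hc
      obtain ⟨v, rfl, rfl⟩ := hij' d b hd
      exact g.map_adj_iff.2 (f.map_adj_iff.1 hcd)
    · exact (adjY a b).1 h
  refine ⟨C, X.map i ⊔ Y.map j, ℓC, ⟨i, restrictX _ _⟩, ⟨j, restrictY _ _⟩,
    ⟨finC, ?_, ?_⟩, hℓi, hℓj, hij⟩
  · refine (acX.map i).sup_of_reachable_inter (acY.map j) (S := Set.range i) (T := Set.range j)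
      ?_ ?_ ?_
    · intro a b hab
      obtain ⟨c, d, -, rfl, -⟩ := (map_adj _ _ _ _).1 hab
      exact ⟨c, rfl⟩
    · intro a b hab
      obtain ⟨c, d, -, rfl, -⟩ := (map_adj _ _ _ _).1 hab
      exact ⟨c, rfl⟩
    · rintro _ ⟨⟨a, rfl⟩, b, hb⟩ _ ⟨⟨c, rfl⟩, d, hd⟩
      obtain ⟨u, rfl, rfl⟩ := hij' a b hb.symm
      obtain ⟨v, rfl, rfl⟩ := hij' c d hd.symm
      refine (hT u v).map (⟨fun u ↦ i (f u), fun {a b} h ↦ ⟨?_, ?_⟩⟩ : T →g X.map i ⊓ Y.map j)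
      · exact (adjX _ _).2 (f.map_adj_iff.2 h)
      · rw [hij, hij]
        exact (adjY _ _).2 (g.map_adj_iff.2 h)
  · rintro v w₁ w₂ (h₁ | h₁) (h₂ | h₂) <;>
      obtain ⟨a, b, hab, rfl, rfl⟩ := (map_adj _ _ _ _).1 h₁ <;>
      obtain ⟨c, d, hcd, hc, rfl⟩ := (map_adj _ _ _ _).1 h₂
    · obtain rfl := i.injective hc
      simpa only [hℓi] using labX c b d hab hcd
    · obtain ⟨u, rfl, rfl⟩ := hij' a c hc.symm
      obtain ⟨x, y, hx, hy, hxy, h⟩ := hdec u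
      have := labX (f u) b x hab hx
      have := labY (g u) y d hy hcd
      simp only [hℓi, hℓj]
      grind
    · obtain ⟨u, rfl, rfl⟩ := hij' c a hc
      obtain ⟨x, y, hx, hy, hxy, h⟩ := hdec u
      have := labX (f u) x d hx hcd
      have := labY (g u) b y hab hy
      simp only [hℓi, hℓj]
      grind
    · obtain rfl := j.injective hc
      simpa only [hℓj] using labY c b d hab hcd

/-- The class `K` has the weak amalgamation property. -/
theorem stmt2 {V : Type} (H : SimpleGraph V) (ℓH : V → ZMod 5) (hH : inK H ℓH) :
    ∃ (V' : Type) (G : SimpleGraph V') (ℓG : V' → ZMod 5) (ι : H ↪g G),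
      inK G ℓG ∧ (∀ v, ℓG (ι v) = ℓH v) ∧
      ∀ (VX VY : Type) (X : SimpleGraph VX) (ℓX : VX → ZMod 5)
        (Y : SimpleGraph VY) (ℓY : VY → ZMod 5) (f : G ↪g X) (g : G ↪g Y),
        inK X ℓX → inK Y ℓY → (∀ v, ℓX (f v) = ℓG v) → (∀ v, ℓY (g v) = ℓG v) →
        ∃ (VW : Type) (W : SimpleGraph VW) (ℓW : VW → ZMod 5)
          (f' : X ↪g W) (g' : Y ↪g W),
          inK W ℓW ∧ (∀ v, ℓW (f' v) = ℓX v) ∧ (∀ v, ℓW (g' v) = ℓY v) ∧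
          ∀ v : V, f' (f (ι v)) = g' (g (ι v)) := by
  obtain ⟨U, T, ℓT, ι, hT, hTree, hι⟩ := hH.exists_isTree
  obtain ⟨V', G, ℓG, e, hG, he, hdec⟩ := hT.exists_decided
  refine ⟨V', G, ℓG, e.comp ι, hG, fun v ↦ (he _).trans (hι v), ?_⟩
  intro VX VY X ℓX Y ℓY f g hX hY hf hg
  obtain ⟨VW, W, ℓW, f', g', hW, hf', hg', hfg⟩ :=
    hX.exists_amalgam hTree.connected.preconnected hY (f.comp e) (g.comp e)
      (fun u ↦ (hf _).trans (hg _).symm) fun u ↦ by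
        obtain ⟨w, hw, h⟩ := hdec u
        refine ⟨f w, g w, f.map_adj_iff.2 hw, g.map_adj_iff.2 hw, (hf _).trans (hg _).symm, ?_⟩
        rw [hf, RelEmbedding.coe_trans, Function.comp_apply, hf, he]
        exact h
  exact ⟨VW, W, ℓW, f', g', hW, hf', hg', fun v ↦ hfg (ι v)⟩
end

section
/- The class 𝒢 has the weak amalgamation property: for every H ∈ 𝒢 there exists G ∈ 𝒢 containing H as an induced subgraph, such that for all X, Y ∈ 𝒢 and all graph embeddings f : G → X and g : G → Y, there exist W ∈ 𝒢 and graph embeddings f' : X → W and g' : Y → W with f' ∘ f and g' ∘ g agreeing on H. -/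
/-- The degree of a vertex (as the cardinality of its neighbor set). -/
noncomputable def deg {V : Type} (G : SimpleGraph V) (v : V) : ℕ :=
  {w | G.Adj v w}.ncard

/-- The class `𝒢`: finite acyclic simple graphs in which no two vertices of degree
greater than `2` are adjacent. -/
def inG {V : Type} (G : SimpleGraph V) : Prop :=
  Finite V ∧ G.IsAcyclic ∧ ∀ v w, G.Adj v w → 2 < deg G v → 2 < deg G w → False

/-! ### Cuts and acyclicity -/

/-- A predicate that is constant along edges is constant along reachability. -/
lemma SimpleGraph.Reachable.iff_of_forall_adj {V : Type} {G : SimpleGraph V} {Q : V → Prop}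
    (hQ : ∀ x y, G.Adj x y → (Q x ↔ Q y)) {a b : V} (h : G.Reachable a b) : Q a ↔ Q b := by
  obtain ⟨p⟩ := h
  induction p with
  | nil => rfl
  | cons hadj _ ih => exact (hQ _ _ hadj).trans ih

/-- `C` is the side of `u` in a cut of `G` whose only crossing edge is `uv`. -/
def IsEdgeCut {V : Type} (G : SimpleGraph V) (u v : V) (C : V → Prop) : Prop :=
  C u ∧ ¬ C v ∧ ∀ x y, G.Adj x y → s(x, y) ≠ s(u, v) → (C x ↔ C y)

lemma IsEdgeCut.symm {V : Type} {G : SimpleGraph V} {u v : V} {C : V → Prop}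
    (h : IsEdgeCut G u v C) : IsEdgeCut G v u (fun x => ¬ C x) :=
  ⟨h.2.1, not_not.2 h.1, fun x y hxy hne =>
    not_congr (h.2.2 x y hxy (by rwa [Sym2.eq_swap (a := u)]))⟩

lemma isAcyclic_iff_forall_exists_isEdgeCut {V : Type} {G : SimpleGraph V} :
    G.IsAcyclic ↔ ∀ u v, G.Adj u v → ∃ C, IsEdgeCut G u v C := by
  rw [SimpleGraph.isAcyclic_iff_forall_adj_isBridge]
  refine forall₂_congr fun u v => forall_congr' fun huv => ?_
  rw [SimpleGraph.isBridge_iff]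
  constructor
  · intro h
    refine ⟨fun x => (G.deleteEdges {s(u, v)}).Reachable u x, .rfl, h, ?_⟩
    intro x y hxy hne
    have hadj : (G.deleteEdges {s(u, v)}).Adj x y :=
      SimpleGraph.deleteEdges_adj.2 ⟨hxy, hne⟩
    exact ⟨fun h => h.trans hadj.reachable, fun h => h.trans hadj.symm.reachable⟩
  · rintro ⟨C, hu, hv, hC⟩ hr
    refine hv ((hr.iff_of_forall_adj (Q := C) ?_).1 hu)
    intro x y hxy
    rw [SimpleGraph.deleteEdges_adj] at hxy
    exact hC x y hxy.1 hxy.2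

/-! ### Degrees -/

lemma deg_le_of_embedding {V W : Type} [Finite W] {G : SimpleGraph V} {X : SimpleGraph W}
    (f : G ↪g X) (v : V) : deg G v ≤ deg X (f v) := by
  unfold deg
  rw [← Set.ncard_image_of_injective _ f.injective]
  refine Set.ncard_le_ncard ?_ (Set.toFinite _)
  rintro _ ⟨w, hw, rfl⟩
  exact f.map_adj_iff.2 hw

lemma exists_adj_eq_of_deg_le {V W : Type} [Finite W] {G : SimpleGraph V} {X : SimpleGraph W}
    (f : G ↪g X) {v : V} (h : deg X (f v) ≤ deg G v) {x : W} (hx : X.Adj (f v) x) :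
    ∃ w, G.Adj v w ∧ f w = x := by
  have hsub : f '' {w | G.Adj v w} ⊆ {w | X.Adj (f v) w} := by
    rintro _ ⟨w, hw, rfl⟩
    exact f.map_adj_iff.2 hw
  have heq := Set.eq_of_subset_of_ncard_le hsub
    (by rwa [Set.ncard_image_of_injective _ f.injective]) (Set.toFinite _)
  have : x ∈ f '' {w | G.Adj v w} := by rw [heq]; exact hx
  exact this

lemma deg_le_of_forall_adj {V W : Type} [Finite V] {G : SimpleGraph V} {X : SimpleGraph W}
    (a : V → W) {v : V} {x : W} (h : ∀ y, X.Adj x y → ∃ w, G.Adj v w ∧ a w = y) :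
    deg X x ≤ deg G v := by
  refine (Set.ncard_le_ncard (t := a '' {w | G.Adj v w}) ?_ (Set.toFinite _)).trans
    (Set.ncard_image_le (Set.toFinite _))
  exact fun y hy => h y hy

/-! ### Free amalgamation over a connected graph -/

/-- A cut at an edge of `X` induces a compatible cut on `Y`, when both contain the
connected graph `T`. -/
lemma IsEdgeCut.exists_compatible {T VX VY : Type} {K : SimpleGraph T} {X : SimpleGraph VX}
    {Y : SimpleGraph VY} (hK : K.Preconnected) (f : K ↪g X) (g : K ↪g Y) (hY : Y.IsAcyclic)
    {u v : VX} (huv : X.Adj u v) {C : VX → Prop} (hC : IsEdgeCut X u v C) :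
    ∃ D : VY → Prop, (∀ t, D (g t) ↔ C (f t)) ∧ ∀ y y', Y.Adj y y' →
      (D y ↔ D y') ∨ ∃ t t', s(f t, f t') = s(u, v) ∧ y = g t ∧ y' = g t' := by
  by_cases h : ∃ t t', f t = u ∧ f t' = v
  · obtain ⟨t₀, t₁, rfl, rfl⟩ := h
    have hadj : Y.Adj (g t₀) (g t₁) := g.map_adj_iff.2 (f.map_adj_iff.1 huv)
    obtain ⟨D, hD⟩ := isAcyclic_iff_forall_exists_isEdgeCut.1 hY _ _ hadj
    refine ⟨D, fun t => ?_, fun y y' hy => ?_⟩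
    · refine ((hK t₀ t).iff_of_forall_adj (Q := fun t => D (g t) ↔ C (f t)) ?_).1
        (iff_of_true hD.1 hC.1)
      intro x y hxy
      by_cases he : s(x, y) = s(t₀, t₁)
      · have hu := hC.1
        have hv := hC.2.1
        have hu' := hD.1
        have hv' := hD.2.1
        rcases Sym2.eq_iff.1 he with ⟨rfl, rfl⟩ | ⟨rfl, rfl⟩ <;> tauto
      · have h₁ := hC.2.2 _ _ (f.map_adj_iff.2 hxy) (by
          simpa [Sym2.eq_iff, f.injective.eq_iff] using he)
        have h₂ := hD.2.2 _ _ (g.map_adj_iff.2 hxy) (by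
          simpa [Sym2.eq_iff, g.injective.eq_iff] using he)
        rw [h₁, h₂]
    · by_cases he : s(y, y') = s(g t₀, g t₁)
      · right
        rcases Sym2.eq_iff.1 he with ⟨rfl, rfl⟩ | ⟨rfl, rfl⟩
        · exact ⟨t₀, t₁, rfl, rfl, rfl⟩
        · exact ⟨t₁, t₀, Sym2.eq_swap, rfl, rfl⟩
      · exact .inl (hD.2.2 _ _ hy he)
  · have hconst : ∀ t t', C (f t) ↔ C (f t') := fun t t' =>
      (hK t t').iff_of_forall_adj (Q := fun t => C (f t)) fun x y hxy =>
        hC.2.2 _ _ (f.map_adj_iff.2 hxy) fun he => by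
          rcases Sym2.eq_iff.1 he with ⟨h₁, h₂⟩ | ⟨h₁, h₂⟩
          · exact h ⟨x, y, h₁, h₂⟩
          · exact h ⟨y, x, h₂, h₁⟩
    exact ⟨fun _ => ∃ t, C (f t),
      fun t => ⟨fun ⟨t', ht'⟩ => (hconst t' t).1 ht', fun ht => ⟨t, ht⟩⟩,
      fun _ _ _ => .inl Iff.rfl⟩

/-- `Z` is the pushout of the injections `f` and `g`, with injections `a` and `b`. -/
structure IsGluing {T VX VY Z : Type} (f : T → VX) (g : T → VY) (a : VX → Z) (b : VY → Z) :
    Prop where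
  left_injective : Function.Injective a
  right_injective : Function.Injective b
  comm : ∀ t, a (f t) = b (g t)
  eq_imp : ∀ x y, a x = b y → ∃ t, f t = x ∧ g t = y

lemma IsGluing.symm {T VX VY Z : Type} {f : T → VX} {g : T → VY} {a : VX → Z} {b : VY → Z}
    (h : IsGluing f g a b) : IsGluing g f b a :=
  ⟨h.2, h.1, fun t => (h.3 t).symm, fun x y e =>
    let ⟨t, h₁, h₂⟩ := h.4 y x e.symm
    ⟨t, h₂, h₁⟩⟩

lemma exists_isGluing {T VX VY : Type} [Finite VX] [Finite VY] {f : T → VX} {g : T → VY}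
    (hf : Function.Injective f) (hg : Function.Injective g) :
    ∃ (Z : Type) (a : VX → Z) (b : VY → Z), Finite Z ∧ IsGluing f g a b := by
  classical
  let b : VY → VX ⊕ {y // y ∉ Set.range g} := fun y =>
    if h : y ∈ Set.range g then .inl (f h.choose) else .inr ⟨y, h⟩
  have hb : ∀ t, b (g t) = .inl (f t) := fun t => by
    have h : g t ∈ Set.range g := ⟨t, rfl⟩
    simp only [b, dif_pos h]
    rw [hg h.choose_spec]
  have hb' : ∀ y (h : y ∉ Set.range g), b y = .inr ⟨y, h⟩ := fun y h => dif_neg h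
  refine ⟨_, Sum.inl, b, inferInstance, Sum.inl_injective, ?_, fun t => (hb t).symm, ?_⟩
  · intro y y' h
    by_cases hy : y ∈ Set.range g <;> by_cases hy' : y' ∈ Set.range g
    · obtain ⟨t, rfl⟩ := hy
      obtain ⟨t', rfl⟩ := hy'
      rw [hb, hb] at h
      rw [hf (Sum.inl_injective h)]
    · obtain ⟨t, rfl⟩ := hy
      rw [hb, hb' _ hy'] at h
      cases h
    · obtain ⟨t', rfl⟩ := hy'
      rw [hb, hb' _ hy] at h
      cases h
    · rw [hb' _ hy, hb' _ hy'] at h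
      simpa using h
  · intro x y h
    by_cases hy : y ∈ Set.range g
    · obtain ⟨t, rfl⟩ := hy
      rw [hb] at h
      exact ⟨t, (Sum.inl_injective h).symm, rfl⟩
    · rw [hb' _ hy] at h
      cases h

/-- The union of the images of `X` and `Y`. -/
def glue {VX VY Z : Type} (X : SimpleGraph VX) (Y : SimpleGraph VY) (a : VX → Z) (b : VY → Z) :
    SimpleGraph Z :=
  X.map a ⊔ Y.map b

section Glue

variable {T VX VY Z : Type} {K : SimpleGraph T} {X : SimpleGraph VX} {Y : SimpleGraph VY}
  {f : K ↪g X} {g : K ↪g Y} {a : VX → Z} {b : VY → Z}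

lemma IsGluing.glue_adj (h : IsGluing f g a b) {z z' : Z} :
    (glue X Y a b).Adj z z' ↔ (∃ x x', X.Adj x x' ∧ a x = z ∧ a x' = z') ∨
      ∃ y y', Y.Adj y y' ∧ b y = z ∧ b y' = z' :=
  or_congr (SimpleGraph.map_adj ⟨a, h.1⟩ X z z') (SimpleGraph.map_adj ⟨b, h.2⟩ Y z z')

lemma glue_comm : glue X Y a b = glue Y X b a :=
  sup_comm _ _

lemma IsGluing.glue_adj_left (h : IsGluing f g a b) {x x' : VX} :
    (glue X Y a b).Adj (a x) (a x') ↔ X.Adj x x' := by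
  rw [h.glue_adj]
  constructor
  · rintro (⟨x₁, x₂, hx, e₁, e₂⟩ | ⟨y₁, y₂, hy, e₁, e₂⟩)
    · rwa [← h.1 e₁, ← h.1 e₂]
    · obtain ⟨t, rfl, rfl⟩ := h.4 _ _ e₁.symm
      obtain ⟨t', rfl, rfl⟩ := h.4 _ _ e₂.symm
      exact f.map_adj_iff.2 (g.map_adj_iff.1 hy)
  · exact fun hx => .inl ⟨x, x', hx, rfl, rfl⟩

lemma IsGluing.glue_adj_right (h : IsGluing f g a b) {y y' : VY} :
    (glue X Y a b).Adj (b y) (b y') ↔ Y.Adj y y' := by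
  rw [glue_comm]
  exact h.symm.glue_adj_left (X := Y) (Y := X) (f := g) (g := f)

lemma IsGluing.exists_isEdgeCut_left (h : IsGluing f g a b) (hK : K.Preconnected)
    (hX : X.IsAcyclic) (hY : Y.IsAcyclic) {u v : VX} (huv : X.Adj u v) :
    ∃ C, IsEdgeCut (glue X Y a b) (a u) (a v) C := by
  obtain ⟨C, hC⟩ := isAcyclic_iff_forall_exists_isEdgeCut.1 hX _ _ huv
  obtain ⟨D, hDC, hD⟩ := hC.exists_compatible hK f g hY huv
  let E : Z → Prop := fun z => (∃ x, a x = z ∧ C x) ∨ ∃ y, b y = z ∧ D y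
  have hEa : ∀ x, E (a x) ↔ C x := by
    refine fun x => ⟨?_, fun hx => .inl ⟨x, rfl, hx⟩⟩
    rintro (⟨x', e, hx⟩ | ⟨y, e, hy⟩)
    · rwa [← h.1 e]
    · obtain ⟨t, rfl, rfl⟩ := h.4 _ _ e.symm
      exact (hDC t).1 hy
  have hEb : ∀ y, E (b y) ↔ D y := by
    refine fun y => ⟨?_, fun hy => .inr ⟨y, rfl, hy⟩⟩
    rintro (⟨x, e, hx⟩ | ⟨y', e, hy⟩)
    · obtain ⟨t, rfl, rfl⟩ := h.4 _ _ e
      exact (hDC t).2 hx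
    · rwa [← h.2 e]
  refine ⟨E, (hEa u).2 hC.1, fun hv => hC.2.1 ((hEa v).1 hv), fun z z' hz hne => ?_⟩
  rcases h.glue_adj.1 hz with ⟨x, x', hx, rfl, rfl⟩ | ⟨y, y', hy, rfl, rfl⟩
  · rw [hEa, hEa]
    refine hC.2.2 _ _ hx fun he => hne ?_
    simpa using congrArg (Sym2.map a) he
  · rw [hEb, hEb]
    refine (hD _ _ hy).resolve_right ?_
    rintro ⟨t, t', he, rfl, rfl⟩
    refine hne ?_
    rw [← h.3, ← h.3]
    simpa using congrArg (Sym2.map a) he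

lemma IsGluing.isAcyclic_glue (h : IsGluing f g a b) (hK : K.Preconnected)
    (hX : X.IsAcyclic) (hY : Y.IsAcyclic) : (glue X Y a b).IsAcyclic := by
  rw [isAcyclic_iff_forall_exists_isEdgeCut]
  intro z z' hz
  rcases h.glue_adj.1 hz with ⟨x, x', hx, rfl, rfl⟩ | ⟨y, y', hy, rfl, rfl⟩
  · exact h.exists_isEdgeCut_left hK hX hY hx
  · rw [glue_comm]
    exact h.symm.exists_isEdgeCut_left (f := g) (g := f) hK hY hX hy

lemma IsGluing.two_lt_deg_left (h : IsGluing f g a b) [Finite T] [Finite VX] [Finite VY]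
    (hdeg : ∀ t, 2 < deg X (f t) ∨
      deg X (f t) ≤ deg K t ∧ deg Y (g t) ≤ deg K t ∧ deg K t ≤ 2)
    {x : VX} (hx : 2 < deg (glue X Y a b) (a x)) : 2 < deg X x := by
  by_cases hxf : x ∈ Set.range f
  · obtain ⟨t, rfl⟩ := hxf
    refine (hdeg t).resolve_right ?_
    rintro ⟨hX, hY, h2⟩
    refine absurd hx (not_lt.2 (le_trans ?_ h2))
    refine deg_le_of_forall_adj (fun t => a (f t)) fun z hz => ?_
    rcases h.glue_adj.1 hz with ⟨x₁, x₂, hx, e, rfl⟩ | ⟨y₁, y₂, hy, e, rfl⟩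
    · rw [h.1 e] at hx
      obtain ⟨w, hw, rfl⟩ := exists_adj_eq_of_deg_le f hX hx
      exact ⟨w, hw, rfl⟩
    · rw [h.3] at e
      rw [h.2 e] at hy
      obtain ⟨w, hw, rfl⟩ := exists_adj_eq_of_deg_le g hY hy
      exact ⟨w, hw, h.3 w⟩
  · refine hx.trans_le (deg_le_of_forall_adj a fun z hz => ?_)
    rcases h.glue_adj.1 hz with ⟨x₁, x₂, hx, e, rfl⟩ | ⟨y₁, y₂, hy, e, rfl⟩
    · rw [h.1 e] at hx
      exact ⟨x₂, hx, rfl⟩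
    · obtain ⟨t, rfl, -⟩ := h.4 _ _ e.symm
      exact absurd ⟨t, rfl⟩ hxf

end Glue

/-- Amalgamation in `𝒢` over a connected graph each of whose vertices either has degree greater
than `2` on both sides, or has degree at most `2` and gains no neighbour on either side. -/
lemma exists_amalgam {T VX VY : Type} {K : SimpleGraph T} {X : SimpleGraph VX}
    {Y : SimpleGraph VY} (hK : K.Preconnected) (f : K ↪g X) (g : K ↪g Y) (hX : inG X)
    (hY : inG Y) (hdeg : ∀ t, (2 < deg X (f t) ∧ 2 < deg Y (g t)) ∨
      deg X (f t) ≤ deg K t ∧ deg Y (g t) ≤ deg K t ∧ deg K t ≤ 2) :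
    ∃ (VW : Type) (W : SimpleGraph VW) (f' : X ↪g W) (g' : Y ↪g W),
      inG W ∧ ∀ t, f' (f t) = g' (g t) := by
  have := hX.1
  have := hY.1
  have : Finite T := .of_injective f f.injective
  obtain ⟨Z, a, b, hZ, h⟩ := exists_isGluing f.injective g.injective
  refine ⟨Z, glue X Y a b, ⟨⟨a, h.1⟩, h.glue_adj_left⟩, ⟨⟨b, h.2⟩, h.glue_adj_right⟩,
    ⟨hZ, h.isAcyclic_glue hK hX.2.1 hY.2.1, ?_⟩, h.3⟩
  have hl : ∀ x, 2 < deg (glue X Y a b) (a x) → 2 < deg X x := fun x =>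
    h.two_lt_deg_left fun t => (hdeg t).imp_left And.left
  have hr : ∀ y, 2 < deg (glue X Y a b) (b y) → 2 < deg Y y := fun y => by
    rw [glue_comm]
    exact h.symm.two_lt_deg_left (f := g) (g := f) fun t =>
      (hdeg t).imp And.right fun ⟨h₁, h₂, h₃⟩ => ⟨h₂, h₁, h₃⟩
  intro z z' hz h₁ h₂
  rcases h.glue_adj.1 hz with ⟨x, x', hx, rfl, rfl⟩ | ⟨y, y', hy, rfl, rfl⟩
  · exact hX.2.2 _ _ hx (hl _ h₁) (hl _ h₂)
  · exact hY.2.2 _ _ hy (hr _ h₁) (hr _ h₂)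

/-! ### Attaching pendant vertices -/

/-- The graph `G` with, for each `q : P`, a new vertex attached to `p q`. -/
def pendant {V P : Type} (G : SimpleGraph V) (p : P → V) : SimpleGraph (V ⊕ P) where
  Adj
    | .inl v, .inl w => G.Adj v w
    | .inl v, .inr q => p q = v
    | .inr q, .inl v => p q = v
    | .inr _, .inr _ => False
  symm := ⟨by
    rintro (v | q) (w | r) h
    exacts [SimpleGraph.Adj.symm h, h, h, h]⟩
  loopless := ⟨by
    rintro (v | q) h
    exacts [G.loopless.irrefl v h, h]⟩

section Pendant

variable {V P : Type} (G : SimpleGraph V) (p : P → V)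

lemma pendant_adj_inl_inl {v w : V} : (pendant G p).Adj (.inl v) (.inl w) ↔ G.Adj v w := Iff.rfl

lemma pendant_adj_inl_inr {v : V} {q : P} : (pendant G p).Adj (.inl v) (.inr q) ↔ p q = v :=
  Iff.rfl

lemma pendant_adj_inr_inl {v : V} {q : P} : (pendant G p).Adj (.inr q) (.inl v) ↔ p q = v :=
  Iff.rfl

lemma pendant_not_adj_inr_inr {q r : P} : ¬ (pendant G p).Adj (.inr q) (.inr r) := id

/-- The inclusion of `G` into `pendant G p`. -/
def pendantInl : G ↪g pendant G p := ⟨⟨Sum.inl, Sum.inl_injective⟩, Iff.rfl⟩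

lemma pendant_preconnected (hG : G.Preconnected) : (pendant G p).Preconnected := by
  have hl : ∀ v w, (pendant G p).Reachable (.inl v) (.inl w) := fun v w =>
    (hG v w).map (pendantInl G p).toHom
  have hr : ∀ q, (pendant G p).Reachable (.inr q) (.inl (p q)) := fun q =>
    SimpleGraph.Adj.reachable ((pendant_adj_inr_inl G p).2 rfl)
  rintro (v | q) (w | r)
  · exact hl v w
  · exact (hl v _).trans (hr r).symm
  · exact (hr q).trans (hl _ w)
  · exact (hr q).trans ((hl _ _).trans (hr r).symm)

lemma pendant_isAcyclic (hG : G.IsAcyclic) : (pendant G p).IsAcyclic := by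
  rw [isAcyclic_iff_forall_exists_isEdgeCut]
  have hpend : ∀ q, IsEdgeCut (pendant G p) (.inr q) (.inl (p q)) (· = .inr q) := by
    refine fun q => ⟨rfl, by simp, ?_⟩
    rintro (v | r) (w | r') h hne
    · simp
    · rw [pendant_adj_inl_inr] at h
      subst h
      simp only [reduceCtorEq, Sum.inr.injEq, false_iff]
      rintro rfl
      exact hne Sym2.eq_swap
    · rw [pendant_adj_inr_inl] at h
      subst h
      simp only [reduceCtorEq, Sum.inr.injEq, iff_false]
      rintro rfl
      exact hne rfl
    · exact absurd h (pendant_not_adj_inr_inr G p)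
  rintro (u | q) (v | r) h
  · obtain ⟨C, hu, hv, hC⟩ := isAcyclic_iff_forall_exists_isEdgeCut.1 hG u v h
    refine ⟨Sum.elim C (fun q => C (p q)), hu, hv, ?_⟩
    rintro (x | q) (y | r) hxy hne
    · exact hC x y hxy fun he => hne (by simpa [Sym2.eq_iff] using he)
    · rw [pendant_adj_inl_inr] at hxy
      simp [hxy]
    · rw [pendant_adj_inr_inl] at hxy
      simp [hxy]
    · exact absurd hxy (pendant_not_adj_inr_inr G p)
  · obtain rfl := (pendant_adj_inl_inr G p).1 h
    exact ⟨_, (hpend r).symm⟩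
  · obtain rfl := (pendant_adj_inr_inl G p).1 h
    exact ⟨_, hpend q⟩
  · exact absurd h (pendant_not_adj_inr_inr G p)

lemma deg_pendant_inl [Finite V] [Finite P] (v : V) :
    deg (pendant G p) (.inl v) = deg G v + {q | p q = v}.ncard := by
  have hset : {w | (pendant G p).Adj (.inl v) w} =
      Sum.inl '' {w | G.Adj v w} ∪ Sum.inr '' {q | p q = v} := by
    ext (w | q)
    · simp [pendant_adj_inl_inl]
    · simp [pendant_adj_inl_inr]
  unfold deg
  rw [hset, Set.ncard_union_eq _ (Set.toFinite _) (Set.toFinite _),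
    Set.ncard_image_of_injective _ Sum.inl_injective,
    Set.ncard_image_of_injective _ Sum.inr_injective]
  rw [Set.disjoint_left]
  rintro _ ⟨w, -, rfl⟩ ⟨q, -, hq⟩
  cases hq

lemma deg_pendant_inr (q : P) : deg (pendant G p) (.inr q) = 1 := by
  unfold deg
  rw [Set.ncard_eq_one]
  refine ⟨.inl (p q), ?_⟩
  ext (w | r)
  · simp [pendant_adj_inr_inl, eq_comm]
  · simp [pendant_not_adj_inr_inr]

end Pendant

/-! ### Connecting the components -/

/-- The graph `G` with a new vertex for each component `c`, attached to `r c`, and a further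
new vertex joined to all of these. -/
def connecting {V : Type} (G : SimpleGraph V) (r : G.ConnectedComponent → V) :
    SimpleGraph (V ⊕ Option G.ConnectedComponent) where
  Adj
    | .inl v, .inl w => G.Adj v w
    | .inl v, .inr (some c) => r c = v
    | .inr (some c), .inl v => r c = v
    | .inr (some _), .inr none => True
    | .inr none, .inr (some _) => True
    | _, _ => False
  symm := ⟨by
    rintro (v | _ | c) (w | _ | d) h
    all_goals first | exact h | exact SimpleGraph.Adj.symm h⟩
  loopless := ⟨by
    rintro (v | _ | c) h
    exacts [G.loopless.irrefl v h, h, h]⟩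

section Connecting

variable {V : Type} (G : SimpleGraph V) (r : G.ConnectedComponent → V)

/-- The inclusion of `G` into `connecting G r`. -/
def connectingInl : G ↪g connecting G r := ⟨⟨Sum.inl, Sum.inl_injective⟩, Iff.rfl⟩

lemma connecting_preconnected (hr : ∀ c, G.connectedComponentMk (r c) = c) :
    (connecting G r).Preconnected := by
  have hc : ∀ c, (connecting G r).Reachable (.inr (some c)) (.inr none) := fun c =>
    SimpleGraph.Adj.reachable trivial
  have hcenter : ∀ z, (connecting G r).Reachable z (.inr none) := by
    rintro (v | _ | c)
    · have h₁ : G.Reachable v (r (G.connectedComponentMk v)) :=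
        SimpleGraph.ConnectedComponent.exact (hr _).symm
      have h₂ : (connecting G r).Adj (.inl (r (G.connectedComponentMk v)))
        (.inr (some (G.connectedComponentMk v))) := rfl
      exact (h₁.map (connectingInl G r).toHom).trans (h₂.reachable.trans (hc _))
    · exact .rfl
    · exact hc c
  exact fun z z' => (hcenter z).trans (hcenter z').symm

lemma connecting_isAcyclic (hr : ∀ c, G.connectedComponentMk (r c) = c)
    (hG : G.IsAcyclic) : (connecting G r).IsAcyclic := by
  classical
  rw [isAcyclic_iff_forall_exists_isEdgeCut]
  have hmk : ∀ {x y}, G.Adj x y → G.connectedComponentMk x = G.connectedComponentMk y :=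
    fun h => SimpleGraph.ConnectedComponent.sound h.reachable
  have hrep : ∀ c, IsEdgeCut (connecting G r) (.inl (r c)) (.inr (some c))
      (Sum.elim (fun x => G.connectedComponentMk x = c) fun _ => False) := by
    refine fun c => ⟨hr c, id, ?_⟩
    rintro (x | _ | d) (y | _ | e) h hne
    · simp [hmk h]
    · exact h.elim
    · obtain rfl : r e = x := h
      simp only [Sum.elim_inl, Sum.elim_inr, iff_false, hr]
      rintro rfl
      exact hne rfl
    · exact h.elim
    · rfl
    · rfl
    · obtain rfl : r d = y := h
      simp only [Sum.elim_inl, Sum.elim_inr, false_iff, hr]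
      rintro rfl
      exact hne Sym2.eq_swap
    · rfl
    · rfl
  have hcen : ∀ c, IsEdgeCut (connecting G r) (.inr (some c)) (.inr none)
      (Sum.elim (fun x => G.connectedComponentMk x = c) (· = some c)) := by
    refine fun c => ⟨rfl, by simp, ?_⟩
    rintro (x | _ | d) (y | _ | e) h hne
    · simp [hmk h]
    · exact h.elim
    · obtain rfl : r e = x := h
      simp [hr]
    · exact h.elim
    · rfl
    · simp only [Sum.elim_inr, reduceCtorEq, false_iff, Option.some.injEq]
      rintro rfl
      exact hne Sym2.eq_swap
    · obtain rfl : r d = y := h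
      simp [hr]
    · simp only [Sum.elim_inr, reduceCtorEq, iff_false, Option.some.injEq]
      rintro rfl
      exact hne rfl
    · exact h.elim
  rintro (u | _ | c) (v | _ | d) h
  · obtain ⟨C, hu, hv, hC⟩ := isAcyclic_iff_forall_exists_isEdgeCut.1 hG u v h
    have huv := hmk h
    set c₀ := G.connectedComponentMk u with hc₀
    refine ⟨Sum.elim (fun x => if G.connectedComponentMk x = c₀ then C x else C (r c₀))
      fun _ => C (r c₀), by simpa [← hc₀], by simpa [← huv], ?_⟩
    have hrc : ∀ d, (if d = c₀ then C (r d) else C (r c₀)) = C (r c₀) := by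
      intro d
      split_ifs with hd
      · rw [hd]
      · rfl
    rintro (x | _ | d) (y | _ | e) hxy hne
    · have hxy' := hC x y hxy fun he => hne (by simpa [Sym2.eq_iff] using he)
      simp only [Sum.elim_inl, hmk hxy, hxy']
    · exact hxy.elim
    · obtain rfl : r e = x := hxy
      simp only [Sum.elim_inl, Sum.elim_inr, hr, hrc]
    · exact hxy.elim
    · rfl
    · rfl
    · obtain rfl : r d = y := hxy
      simp only [Sum.elim_inl, Sum.elim_inr, hr, hrc]
    · rfl
    · rfl
  · exact h.elim
  · obtain rfl : r d = u := h
    exact ⟨_, hrep d⟩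
  · exact h.elim
  · exact h.elim
  · exact ⟨_, (hcen d).symm⟩
  · obtain rfl : r c = v := h
    exact ⟨_, (hrep c).symm⟩
  · exact ⟨_, hcen c⟩
  · exact h.elim

lemma deg_connecting_some_le (c : G.ConnectedComponent) :
    deg (connecting G r) (.inr (some c)) ≤ 2 := by
  refine (Set.ncard_le_ncard (t := {.inl (r c), .inr none}) ?_ (Set.toFinite _)).trans
    (Set.ncard_insert_le _ _ |>.trans (by simp))
  rintro (v | _ | d) h
  · obtain rfl : r c = v := h
    simp
  · simp
  · exact h.elim

lemma deg_connecting_inl_le [Finite V] {v : V} (hv : ∀ c, r c ≠ v) :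
    deg (connecting G r) (.inl v) ≤ deg G v := by
  refine deg_le_of_forall_adj Sum.inl ?_
  rintro (w | _ | c) h
  · exact ⟨w, h, rfl⟩
  · exact h.elim
  · exact absurd h (hv c)

lemma inG_connecting (hr : ∀ c, G.connectedComponentMk (r c) = c) (hG : inG G)
    (hav : ∀ c w, G.Adj (r c) w → deg G w ≤ 2) : inG (connecting G r) := by
  have := hG.1
  refine ⟨inferInstance, connecting_isAcyclic G r hr hG.2.1, ?_⟩
  have hadj : ∀ c w, G.Adj (r c) w → deg (connecting G r) (.inl w) ≤ 2 := by
    intro c w hw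
    refine (deg_connecting_inl_le G r ?_).trans (hav c w hw)
    rintro d rfl
    have h := SimpleGraph.ConnectedComponent.sound hw.reachable
    rw [hr, hr] at h
    rw [h] at hw
    exact hw.ne rfl
  rintro (v | _ | c) (w | _ | d) h h₁ h₂
  · by_cases hv : ∃ c, r c = v
    · obtain ⟨c, rfl⟩ := hv
      exact absurd (hadj c w h) (not_le.2 h₂)
    by_cases hw : ∃ c, r c = w
    · obtain ⟨c, rfl⟩ := hw
      exact absurd (hadj c v (SimpleGraph.Adj.symm h)) (not_le.2 h₁)
    push Not at hv hw
    exact hG.2.2 v w h (h₁.trans_le (deg_connecting_inl_le G r hv))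
      (h₂.trans_le (deg_connecting_inl_le G r hw))
  · exact h
  · exact absurd (deg_connecting_some_le G r d) (not_le.2 h₂)
  · exact h
  · exact h
  · exact absurd (deg_connecting_some_le G r d) (not_le.2 h₂)
  · exact absurd (deg_connecting_some_le G r c) (not_le.2 h₁)
  · exact absurd (deg_connecting_some_le G r c) (not_le.2 h₁)
  · exact h

end Connecting

/-- Every graph in `𝒢` embeds in a connected one. -/
lemma exists_preconnected_extension {V : Type} (H : SimpleGraph V) (hH : inG H) :
    ∃ (T : Type) (K : SimpleGraph T) (_ : H ↪g K), inG K ∧ K.Preconnected := by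
  have hex : ∀ c : H.ConnectedComponent, ∃ v, H.connectedComponentMk v = c ∧
      ∀ w, H.Adj v w → deg H w ≤ 2 := by
    intro c
    induction c using SimpleGraph.ConnectedComponent.ind with | _ v
    by_cases h : ∃ w, H.Adj v w ∧ 2 < deg H w
    · obtain ⟨w, hvw, hw⟩ := h
      exact ⟨w, SimpleGraph.ConnectedComponent.sound hvw.symm.reachable,
        fun x hx => not_lt.1 (hH.2.2 w x hx hw)⟩
    · push Not at h
      exact ⟨v, rfl, h⟩
  choose r hr hav using hex
  exact ⟨_, connecting H r, connectingInl H r, inG_connecting H r hr hH hav,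
    connecting_preconnected H r hr⟩

/-! ### Determining the vertices of large degree -/

lemma exists_maximal_independent {V : Type} [Finite V] (G : SimpleGraph V) (A : Set V)
    (hA : ∀ v ∈ A, ∀ w ∈ A, ¬ G.Adj v w) :
    ∃ B : Set V, A ⊆ B ∧ (∀ v ∈ B, ∀ w ∈ B, ¬ G.Adj v w) ∧
      ∀ v ∉ B, ∃ w ∈ B, G.Adj v w := by
  obtain ⟨B, hAB, hB⟩ :=
    Finite.exists_le_maximal (p := fun B : Set V => ∀ v ∈ B, ∀ w ∈ B, ¬ G.Adj v w) hA
  refine ⟨B, hAB, hB.1, fun v hv => ?_⟩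
  by_contra! hno
  refine hv (hB.2 (y := insert v B) ?_ (Set.subset_insert v B) (Set.mem_insert v B))
  rintro x (rfl | hx) y (rfl | hy)
  · exact G.loopless.irrefl _
  · exact hno y hy
  · exact fun h => hno x hx h.symm
  · exact hB.1 x hx y hy

/-- Every connected graph in `𝒢` embeds in a connected acyclic one with an independent
dominating set outside of which all degrees are `2`. -/
lemma exists_dominating_extension {V : Type} (G : SimpleGraph V) (hG : inG G)
    (hconn : G.Preconnected) :
    ∃ (T : Type) (K : SimpleGraph T) (_ : G ↪g K) (B : Set T), Finite T ∧ K.IsAcyclic ∧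
      K.Preconnected ∧ (∀ v ∈ B, ∀ w ∈ B, ¬ K.Adj v w) ∧
      ∀ v ∉ B, deg K v = 2 ∧ ∃ w ∈ B, K.Adj v w := by
  have := hG.1
  obtain ⟨B, hbig, hind, hdom⟩ := exists_maximal_independent G {v | 2 < deg G v}
    fun v hv w hw h => hG.2.2 v w h hv hw
  let L : Set V := {v | v ∉ B ∧ deg G v ≠ 2}
  let p : L → V := Subtype.val
  refine ⟨V ⊕ L, pendant G p, pendantInl G p, Sum.inl '' B ∪ Set.range Sum.inr, inferInstance,
    pendant_isAcyclic G p hG.2.1, pendant_preconnected G p hconn, ?_, ?_⟩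
  · rintro _ (⟨v, hv, rfl⟩ | ⟨q, rfl⟩) _ (⟨w, hw, rfl⟩ | ⟨q', rfl⟩) h
    · exact hind v hv w hw h
    · obtain rfl := (pendant_adj_inl_inr G p).1 h
      exact q'.2.1 hv
    · obtain rfl := (pendant_adj_inr_inl G p).1 h
      exact q.2.1 hw
    · exact pendant_not_adj_inr_inr G p h
  · rintro (v | q) hv
    · have hvB : v ∉ B := fun h => hv (.inl ⟨v, h, rfl⟩)
      obtain ⟨w, hw, hvw⟩ := hdom v hvB
      refine ⟨?_, .inl w, .inl ⟨w, hw, rfl⟩, hvw⟩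
      rw [deg_pendant_inl]
      by_cases hL : v ∈ L
      · have hfib : {q | p q = v} = {⟨v, hL⟩} := by
          ext q
          simp [p, Subtype.ext_iff]
        have hle : deg G v ≤ 2 := not_lt.1 fun h => hvB (hbig h)
        have hpos : 0 < deg G v := (Set.ncard_pos (Set.toFinite _)).2 ⟨w, hvw⟩
        have hne := hL.2
        rw [hfib, Set.ncard_singleton]
        omega
      · have hfib : {q | p q = v} = ∅ := by
          ext q
          simp only [Set.mem_ofPred_eq, Set.mem_empty_iff_false, iff_false]
          rintro rfl
          exact hL q.2
        rw [hfib, Set.ncard_empty, add_zero]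
        by_contra hne
        exact hL ⟨hvB, hne⟩
    · exact absurd (.inr ⟨q, rfl⟩) hv

/-- Attaching three pendant vertices to each vertex of an independent set `B` outside of which
all degrees are `2` yields a graph in `𝒢` where the vertices of `B` have degree greater
than `2`. -/
lemma exists_large_degree_extension {T : Type} [Finite T] (K : SimpleGraph T)
    (hK : K.IsAcyclic) (B : Set T) (hind : ∀ v ∈ B, ∀ w ∈ B, ¬ K.Adj v w)
    (hdeg : ∀ v ∉ B, deg K v = 2) :
    ∃ (V : Type) (G : SimpleGraph V) (j : K ↪g G), inG G ∧ ∀ v ∈ B, 2 < deg G (j v) := by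
  let p : B × Fin 3 → T := fun q => q.1
  refine ⟨_, pendant K p, pendantInl K p, ⟨inferInstance, pendant_isAcyclic K p hK, ?_⟩, ?_⟩
  · have hB : ∀ v, 2 < deg (pendant K p) (.inl v) → v ∈ B := by
      intro v hv
      by_contra hvB
      have hfib : {q | p q = v} = ∅ := by
        ext q
        simp only [Set.mem_ofPred_eq, Set.mem_empty_iff_false, iff_false]
        rintro rfl
        exact hvB q.1.2
      rw [deg_pendant_inl, hfib, Set.ncard_empty, hdeg v hvB] at hv
      omega
    rintro (v | q) (w | r) h h₁ h₂
    · exact hind v (hB v h₁) w (hB w h₂) h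
    · rw [deg_pendant_inr] at h₂
      omega
    · rw [deg_pendant_inr] at h₁
      omega
    · rw [deg_pendant_inr] at h₁
      omega
  · intro v hv
    have hsub : Set.range (fun i : Fin 3 => ((⟨v, hv⟩, i) : B × Fin 3)) ⊆ {q | p q = v} := by
      rintro _ ⟨i, rfl⟩
      rfl
    have hcard := Set.ncard_le_ncard hsub (Set.toFinite _)
    rw [← Set.image_univ, Set.ncard_image_of_injective _ (fun i i' h => (Prod.ext_iff.1 h).2),
      Set.ncard_univ, Nat.card_fin] at hcard
    have h := deg_pendant_inl K p v
    change 2 < deg (pendant K p) (.inl v)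
    omega

/-- The class `𝒢` has the weak amalgamation property. -/
theorem stmt7 {V : Type} (H : SimpleGraph V) (hH : inG H) :
    ∃ (V' : Type) (G : SimpleGraph V') (ι : H ↪g G),
      inG G ∧
      ∀ (VX VY : Type) (X : SimpleGraph VX) (Y : SimpleGraph VY)
        (f : G ↪g X) (g : G ↪g Y),
        inG X → inG Y →
        ∃ (VW : Type) (W : SimpleGraph VW) (f' : X ↪g W) (g' : Y ↪g W),
          inG W ∧ ∀ v : V, f' (f (ι v)) = g' (g (ι v)) := by
  obtain ⟨T₀, K₀, i₀, hK₀, hconn₀⟩ := exists_preconnected_extension H hH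
  obtain ⟨T, K, i, B, hT, hK, hconn, hind, hB⟩ := exists_dominating_extension K₀ hK₀ hconn₀
  obtain ⟨V', G, j, hG, hlarge⟩ :=
    exists_large_degree_extension K hK B hind fun v hv => (hB v hv).1
  refine ⟨V', G, (i₀.trans i).trans j, hG, fun VX VY X Y f g hX hY => ?_⟩
  have hbig : ∀ {VZ : Type} {Z : SimpleGraph VZ} (e : G ↪g Z), inG Z → ∀ t ∈ B,
      2 < deg Z (e (j t)) := fun e hZ t ht =>
    have := hZ.1
    (hlarge t ht).trans_le (deg_le_of_embedding e (j t))
  have hsmall : ∀ {VZ : Type} {Z : SimpleGraph VZ} (e : G ↪g Z), inG Z → ∀ t ∉ B,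
      deg Z (e (j t)) ≤ 2 := fun e hZ t ht => by
    obtain ⟨w, hw, htw⟩ := (hB t ht).2
    exact not_lt.1 fun h =>
      hZ.2.2 _ _ (e.map_adj_iff.2 (j.map_adj_iff.2 htw)) h (hbig e hZ w hw)
  obtain ⟨VW, W, f', g', hW, hcomm⟩ := exists_amalgam hconn (j.trans f) (j.trans g) hX hY <| by
    intro t
    by_cases ht : t ∈ B
    · exact .inl ⟨hbig f hX t ht, hbig g hY t ht⟩
    · rw [(hB t ht).1]
      exact .inr ⟨hsmall f hX t ht, hsmall g hY t ht, le_rfl⟩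
  exact ⟨VW, W, f', g', hW, fun v => hcomm (i (i₀ v))⟩
end
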